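/- Let γ > 1, α ∈ (0,1), ε ∈ (0,1). Define the kernel K^{(α),γ}(t,τ) = (1+τ) · sup over nonzero integers k, l of [e^{−α|l|} e^{−α(t−τ)|k−l|/t} e^{−α|k(t−τ)+lτ|} / (1 + |k−l|^γ)] for 0 < τ < t. Then there exists ᾱ(γ) > 0 and a constant C(γ) such that for all α ≤ ᾱ(γ) and all t > 0: e^{−εt} ∫₀^t K^{(α),γ}(t,τ) e^{ετ} dτ ≤ C(γ) [1/(α ε^γ t^{γ−1}) + (1/(α ε^γ t^γ)) log(1/α) + 1/(α² ε^{1+γ} t^{1+γ}) + (1/α³ + (1/(α²ε)) log(1/α)) e^{−εt/4} + e^{−αt/2}/α³]. -/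

import Mathlib

open Real

/-- The plasma-echo interaction kernel `K^{(α),γ}(t,τ)`. -/
noncomputable def echoKernel (α γ t τ : ℝ) : ℝ :=
  (1 + τ) * ⨆ k : {k : ℤ // k ≠ 0}, ⨆ l : {l : ℤ // l ≠ 0},
    Real.exp (-α * |(l.1 : ℝ)|) * Real.exp (-α * (t - τ) * |((k.1 : ℝ) - (l.1 : ℝ))| / t) *
      Real.exp (-α * |(k.1 : ℝ) * (t - τ) + (l.1 : ℝ) * τ|) /
      (1 + |((k.1 : ℝ) - (l.1 : ℝ))| ^ γ)

open MeasureTheory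

theorem telescoping_rpow_le {γ a : ℝ} (hγ : 1 < γ) (ha : 0 < a) :
    (γ - 1) * (a + 1) ^ (-γ) ≤ a ^ (1 - γ) - (a + 1) ^ (1 - γ) := by
  have hb : 0 < a + 1 := by linarith
  have h1 : a ^ (1 - γ) = (a + 1) ^ (1 - γ) * ((a + 1) / a) ^ (γ - 1) := by
    rw [div_rpow hb.le ha.le, ← neg_sub γ 1, rpow_neg ha.le, rpow_neg hb.le]
    have := (rpow_pos_of_pos hb (γ - 1)).ne'
    field_simp
  have h2 : (a + 1) ^ (-γ) = (a + 1) ^ (1 - γ) * (a + 1)⁻¹ := by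
    rw [← rpow_neg_one (a + 1), ← rpow_add hb]; congr 1; ring
  have h3 : 1 + (γ - 1) * (a + 1)⁻¹ ≤ ((a + 1) / a) ^ (γ - 1) := by
    have hr : 0 < (a + 1) / a := by positivity
    have hl : (a + 1)⁻¹ ≤ log ((a + 1) / a) := by
      refine le_trans (le_of_eq ?_) (one_sub_inv_le_log_of_pos hr)
      field_simp; ring
    rw [rpow_def_of_pos hr]
    have := add_one_le_exp (log ((a + 1) / a) * (γ - 1))
    nlinarith
  have h4 := mul_le_mul_of_nonneg_left h3 (rpow_pos_of_pos hb (1 - γ)).le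
  rw [h1, h2]; linarith

theorem ENNReal.tsum_ofReal_rpow_neg_le {γ x : ℝ} (hγ : 1 < γ) (hx : 0 < x) :
    ∑' n : ℕ, ENNReal.ofReal ((n + 1 + x) ^ (-γ)) ≤ ENNReal.ofReal (x ^ (1 - γ) / (γ - 1)) := by
  refine ENNReal.tsum_le_of_sum_range_le fun N => ?_
  rw [← ENNReal.ofReal_sum_of_nonneg fun n _ => by positivity]
  refine ENNReal.ofReal_le_ofReal ?_
  have key : ∑ n ∈ Finset.range N, ((n : ℝ) + 1 + x) ^ (-γ) ≤
      (x ^ (1 - γ) - (N + x) ^ (1 - γ)) / (γ - 1) := by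
    induction N with
    | zero => simp
    | succ N ih =>
      rw [Finset.sum_range_succ]
      refine (add_le_add_left ih _).trans ?_
      have := telescoping_rpow_le hγ (a := N + x) (by positivity)
      have e : (N : ℝ) + x + 1 = N + 1 + x := by ring
      rw [e] at this
      have h1 : 0 < γ - 1 := by linarith
      rw [le_div_iff₀ h1, add_mul, div_mul_cancel₀ _ h1.ne']
      push_cast
      linarith
  refine key.trans ?_
  have : 0 ≤ (N + x) ^ (1 - γ) := by positivity
  gcongr
  linarith

theorem mul_one_add_rpow_le {γ y : ℝ} (hγ : 1 < γ) (hy : 0 < y) :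
    y * (1 + y) ^ γ ≤ (2 * γ) ^ γ * exp (1 / 2) * (exp y - 1) := by
  have h0 : 0 < γ := by linarith
  have h1 : (1 + y) ^ γ ≤ (2 * γ) ^ γ * exp (1 / 2) * exp (y / 2) := by
    have h : 1 + y ≤ 2 * γ * exp ((1 + y) / (2 * γ)) := by
      have := add_one_le_exp ((1 + y) / (2 * γ))
      calc 1 + y = 2 * γ * ((1 + y) / (2 * γ)) := by field_simp
        _ ≤ _ := by gcongr; linarith
    refine (rpow_le_rpow (by positivity) h h0.le).trans (le_of_eq ?_)
    rw [mul_rpow (by positivity) (exp_pos _).le, ← exp_mul, mul_assoc, ← exp_add]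
    congr 2; field_simp
  have h2 : y * exp (y / 2) ≤ exp y - 1 := by
    have h := self_le_sinh_iff.2 (by positivity : 0 ≤ y / 2)
    rw [sinh_eq] at h
    have e1 : exp (y / 2) * exp (y / 2) = exp y := by rw [← exp_add]; congr 1; ring
    have e2 : exp (-(y / 2)) * exp (y / 2) = 1 := by rw [← exp_add]; simp
    nlinarith [exp_pos (y / 2)]
  calc y * (1 + y) ^ γ ≤ y * ((2 * γ) ^ γ * exp (1 / 2) * exp (y / 2)) := by gcongr
    _ = (2 * γ) ^ γ * exp (1 / 2) * (y * exp (y / 2)) := by ring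
    _ ≤ _ := by gcongr

theorem ENNReal.tsum_ofReal_exp_neg {y : ℝ} (hy : 0 < y) :
    ∑' m : ℕ, ENNReal.ofReal (exp (-(y * (m + 1)))) = ENNReal.ofReal (1 / (exp y - 1)) := by
  have h1 : exp (-y) < 1 := by simpa using hy
  have hs : HasSum (fun m : ℕ => exp (-(y * (m + 1)))) (1 / (exp y - 1)) := by
    have h := (hasSum_geometric_of_lt_one (exp_pos (-y)).le h1).mul_left (exp (-y))
    have e1 : ∀ m : ℕ, exp (-(y * (m + 1))) = exp (-y) * exp (-y) ^ m := fun m => by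
      rw [← exp_nat_mul, ← exp_add]; congr 1; ring
    have e2 : 1 / (exp y - 1) = exp (-y) * (1 - exp (-y))⁻¹ := by
      have h2 : 0 < 1 - exp (-y) := by linarith
      have h3 : 0 < exp y - 1 := by linarith [one_lt_exp_iff.2 hy]
      have h4 : exp (-y) * exp y = 1 := by rw [← exp_add]; simp
      rw [← div_eq_mul_inv, div_eq_div_iff h3.ne' h2.ne']
      linarith
    simpa only [e1, e2] using h
  rw [← ENNReal.ofReal_tsum_of_nonneg (fun m => (exp_pos _).le) hs.summable, hs.tsum_eq]

theorem integral_le_of_lintegral_ofReal_le {X : Type*} [MeasurableSpace X] {μ : Measure X}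
    {f : X → ℝ} {M : ℝ} (hf : 0 ≤ᵐ[μ] f) (hM : 0 ≤ M)
    (h : ∫⁻ x, ENNReal.ofReal (f x) ∂μ ≤ ENNReal.ofReal M) : ∫ x, f x ∂μ ≤ M := by
  by_cases hm : AEStronglyMeasurable f μ
  · rw [integral_eq_lintegral_of_nonneg_ae hf hm]
    exact ENNReal.toReal_le_of_le_ofReal hM h
  · rwa [integral_non_aestronglyMeasurable hm]

theorem lintegral_exp_neg_mul_abs_sub {a : ℝ} (ha : 0 < a) (c : ℝ) :
    ∫⁻ x, ENNReal.ofReal (exp (-(a * |x - c|))) = ENNReal.ofReal (2 / a) := by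
  rw [lintegral_sub_right_eq_self (μ := volume) (fun x => ENNReal.ofReal (exp (-(a * |x|)))) c]
  have hI : ∫ x, exp (-(a * |x|)) = 2 / a := by
    rw [integral_comp_abs (f := fun x => exp (-(a * x)))]
    have := integral_exp_mul_Ioi (neg_lt_zero.2 ha) 0
    simp only [neg_mul] at this
    rw [this]; simp; field_simp
  rw [← ofReal_integral_eq_lintegral_ofReal _ (ae_of_all _ fun x => (exp_pos _).le), hI]
  refine not_imp_comm.1 integral_undef ?_
  rw [hI]; positivity

/-- The contribution to the echo kernel of the pair of frequencies `|k - l| = n + 1` and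
`|l| = m + 1` of opposite signs, once `exp (ε * (t - τ))` is factored out. -/
noncomputable def echoMode (α ε γ t : ℝ) (n m : ℕ) (τ : ℝ) : ℝ :=
  ((n + 1 : ℝ) ^ (-γ) * exp (-(α * (m + 1))) *
    (exp (-(3 / 4 * α * ((m + 1) * t))) + exp (-(ε * ((m + 1) * t) / (n + 1))))) *
      exp (-(α / 4 * |(n + 1) * (t - τ) - (m + 1) * t|))

theorem echoMode_nonneg (α ε γ t : ℝ) (n m : ℕ) (τ : ℝ) : 0 ≤ echoMode α ε γ t n m τ := by
  unfold echoMode; positivity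

theorem exp_neg_resonance_le {α ε N s b : ℝ} (hα : 0 < α) (hε : 0 < ε) (hN : 0 < N) (hs : 0 ≤ s) :
    exp (-(α * |N * s - b|)) ≤ exp (ε * s) *
      ((exp (-(3 / 4 * α * b)) + exp (-(ε * b / N))) * exp (-(α / 4 * |N * s - b|))) := by
  have hd := neg_abs_le (N * s - b)
  have hd0 := abs_nonneg (N * s - b)
  set d := |N * s - b|
  have key : exp (-(3 / 4 * α * d)) ≤
      exp (ε * s) * (exp (-(3 / 4 * α * b)) + exp (-(ε * b / N))) := by
    rw [mul_add, ← exp_add, ← exp_add]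
    rcases le_total ε (3 / 4 * α * N) with h | h
    · refine le_add_of_nonneg_of_le (exp_pos _).le (exp_le_exp.2 ?_)
      have h1 : ε * b / N ≤ 3 / 4 * α * d + ε * s := by
        rw [div_le_iff₀ hN]
        nlinarith [mul_le_mul_of_nonneg_right h hd0]
      linarith
    · refine le_add_of_le_of_nonneg (exp_le_exp.2 ?_) (exp_pos _).le
      nlinarith [mul_le_mul_of_nonneg_right h hs]
  calc exp (-(α * d)) = exp (-(3 / 4 * α * d)) * exp (-(α / 4 * d)) := by
        rw [← exp_add]; congr 1; ring
    _ ≤ _ := by rw [← mul_assoc]; gcongr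

theorem echo_term_le_of_same_sign {α γ t τ : ℝ} (hα : 0 < α) (hτ : 0 < τ) (hτt : τ ≤ t)
    {k l : ℝ} (h : 1 ≤ k ∧ 1 ≤ l ∨ k ≤ -1 ∧ l ≤ -1) :
    exp (-α * |l|) * exp (-α * (t - τ) * |k - l| / t) * exp (-α * |k * (t - τ) + l * τ|) /
      (1 + |k - l| ^ γ) ≤ exp (-(α * t)) := by
  have ht : 0 < t := hτ.trans_le hτt
  have hs : 0 ≤ t - τ := by linarith
  have h1 : t ≤ |k * (t - τ) + l * τ| := by
    rcases h with ⟨h, h'⟩ | ⟨h, h'⟩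
    · exact le_trans (by nlinarith) (le_abs_self _)
    · exact le_trans (by nlinarith) (neg_le_abs _)
  have hp : 0 ≤ |k - l| ^ γ := by positivity
  refine (div_le_self (by positivity) (by linarith)).trans ?_
  rw [← exp_add, ← exp_add, exp_le_exp]
  have h2 : 0 ≤ α * (t - τ) * |k - l| / t := by positivity
  have h3 : 0 ≤ α * |l| := by positivity
  have h4 := mul_le_mul_of_nonneg_left h1 hα.le
  have h5 : -α * (t - τ) * |k - l| / t = -(α * (t - τ) * |k - l| / t) := by ring
  linarith

theorem echo_term_le_of_opposite_sign {α ε γ t τ : ℝ} (hα : 0 < α) (hε : 0 < ε) (hτ : 0 < τ)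
    (hτt : τ ≤ t) {k l : ℝ} {n m : ℕ} (hn : |k - l| = n + 1) (hm : |l| = m + 1)
    (hr : |k * (t - τ) + l * τ| = |(n + 1) * (t - τ) - (m + 1) * t|) :
    exp (-α * |l|) * exp (-α * (t - τ) * |k - l| / t) * exp (-α * |k * (t - τ) + l * τ|) /
      (1 + |k - l| ^ γ) ≤ exp (ε * (t - τ)) * echoMode α ε γ t n m τ := by
  have ht : 0 < t := hτ.trans_le hτt
  have hs : 0 ≤ t - τ := by linarith
  rw [hr, hn, hm]
  have hN : (0 : ℝ) < n + 1 := by positivity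
  have h1 : exp (-α * (t - τ) * (n + 1) / t) ≤ 1 := by
    rw [exp_le_one_iff, show -α * (t - τ) * (n + 1) / t = -(α * (t - τ) * (n + 1) / t) by ring]
    have : 0 ≤ α * (t - τ) * (n + 1) / t := by positivity
    linarith
  have h2 := exp_neg_resonance_le (b := (m + 1) * t) hα hε hN hs
  have h3 : (1 + (n + 1 : ℝ) ^ γ)⁻¹ ≤ (n + 1 : ℝ) ^ (-γ) := by
    rw [rpow_neg hN.le]
    gcongr
    linarith
  rw [div_eq_mul_inv]
  calc _ ≤ exp (-α * (m + 1)) * 1 * (exp (ε * (t - τ)) *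
      ((exp (-(3 / 4 * α * ((m + 1) * t))) + exp (-(ε * ((m + 1) * t) / (n + 1)))) *
        exp (-(α / 4 * |(n + 1) * (t - τ) - (m + 1) * t|)))) * (n + 1 : ℝ) ^ (-γ) := by
        rw [neg_mul α |(n + 1) * (t - τ) - (m + 1) * t|]; gcongr
    _ = _ := by unfold echoMode; rw [neg_mul]; ring

theorem echo_term_le {α ε γ t τ : ℝ} (hα : 0 < α) (hε : 0 < ε) (hτ : 0 < τ) (hτt : τ ≤ t)
    {k l : ℤ} (hk : k ≠ 0) (hl : l ≠ 0) :
    exp (-α * |(l : ℝ)|) * exp (-α * (t - τ) * |(k : ℝ) - l| / t) *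
      exp (-α * |(k : ℝ) * (t - τ) + l * τ|) / (1 + |(k : ℝ) - l| ^ γ) ≤ exp (-(α * t)) ∨
    ∃ n m : ℕ, exp (-α * |(l : ℝ)|) * exp (-α * (t - τ) * |(k : ℝ) - l| / t) *
      exp (-α * |(k : ℝ) * (t - τ) + l * τ|) / (1 + |(k : ℝ) - l| ^ γ) ≤
        exp (ε * (t - τ)) * echoMode α ε γ t n m τ := by
  rcases lt_or_gt_of_ne hk with hk | hk <;> rcases lt_or_gt_of_ne hl with hl | hl
  · exact .inl (echo_term_le_of_same_sign hα hτ hτt (.inr ⟨by exact_mod_cast Int.le_sub_one_of_lt hk,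
      by exact_mod_cast Int.le_sub_one_of_lt hl⟩))
  · obtain ⟨n, hn⟩ := Int.eq_ofNat_of_zero_le (show 0 ≤ l - k - 1 by omega)
    obtain ⟨m, hm⟩ := Int.eq_ofNat_of_zero_le (show 0 ≤ l - 1 by omega)
    have hn' : (l : ℝ) - k = n + 1 := by have : l - k = n + 1 := by omega
                                         exact_mod_cast this
    have hm' : (l : ℝ) = m + 1 := by have : l = m + 1 := by omega
                                     exact_mod_cast this
    refine .inr ⟨n, m, echo_term_le_of_opposite_sign hα hε hτ hτt ?_ ?_ ?_⟩
    · rw [abs_sub_comm, hn', abs_of_nonneg (by positivity)]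
    · rw [hm', abs_of_nonneg (by positivity)]
    · rw [← abs_neg, ← hn', ← hm']; congr 1; ring
  · obtain ⟨n, hn⟩ := Int.eq_ofNat_of_zero_le (show 0 ≤ k - l - 1 by omega)
    obtain ⟨m, hm⟩ := Int.eq_ofNat_of_zero_le (show 0 ≤ -l - 1 by omega)
    have hn' : (k : ℝ) - l = n + 1 := by have : k - l = n + 1 := by omega
                                         exact_mod_cast this
    have hm' : -(l : ℝ) = m + 1 := by have : -l = m + 1 := by omega
                                      exact_mod_cast this
    refine .inr ⟨n, m, echo_term_le_of_opposite_sign hα hε hτ hτt ?_ ?_ ?_⟩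
    · rw [hn', abs_of_nonneg (by positivity)]
    · rw [← abs_neg, hm', abs_of_nonneg (by positivity)]
    · rw [← hn', ← hm']; congr 1; ring
  · exact .inl (echo_term_le_of_same_sign hα hτ hτt (.inl ⟨by exact_mod_cast hk,
      by exact_mod_cast hl⟩))

theorem lintegral_echoMode_le {α ε γ t : ℝ} (hα : 0 < α) (n m : ℕ) (s : Set ℝ) :
    ∫⁻ τ in s, ENNReal.ofReal (echoMode α ε γ t n m τ) ≤
      ENNReal.ofReal (8 / α * (n + 1 : ℝ) ^ (-(γ + 1)) * (exp (-(α * (m + 1))) *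
        (exp (-(3 / 4 * α * ((m + 1) * t))) + exp (-(ε * ((m + 1) * t) / (n + 1)))))) := by
  have hN : (0 : ℝ) < n + 1 := by positivity
  have h : ∀ τ, α / 4 * |(n + 1) * (t - τ) - (m + 1) * t| =
      α / 4 * (n + 1) * |τ - (t - (m + 1) * t / (n + 1))| := fun τ => by
    rw [mul_assoc, ← abs_of_pos hN, ← abs_mul, abs_of_pos hN, ← abs_neg]
    congr 2; field_simp; ring
  refine (setLIntegral_le_lintegral s _).trans (le_of_eq ?_)
  simp_rw [echoMode, h, ENNReal.ofReal_mul' (exp_pos (-(α / 4 * (n + 1) * _))).le]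
  rw [lintegral_const_mul' _ _ ENNReal.ofReal_ne_top,
    lintegral_exp_neg_mul_abs_sub (by positivity), ← ENNReal.ofReal_mul (by positivity),
    neg_add, rpow_add hN, rpow_neg_one]
  congr 1; field_simp; ring

theorem rpow_div_exp_sub_one_le {γ N x : ℝ} (hγ : 1 < γ) (hN : 0 < N) (hx : 0 < x) :
    N ^ (-(γ + 1)) * (1 / (exp (x / N) - 1)) ≤
      (2 * γ) ^ γ * exp (1 / 2) * x⁻¹ * (N + x) ^ (-γ) := by
  have h := mul_one_add_rpow_le hγ (div_pos hx hN)
  have h1 : 0 < exp (x / N) - 1 := by linarith [one_lt_exp_iff.2 (div_pos hx hN)]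
  have e : 1 + x / N = (N + x) / N := by field_simp
  rw [e, div_rpow (by positivity) hN.le] at h
  rw [neg_add, rpow_add hN, rpow_neg_one, rpow_neg hN.le, rpow_neg (by positivity), mul_one_div,
    div_le_iff₀ h1]
  have hp : 0 < N ^ γ := by positivity
  have hq : 0 < (N + x) ^ γ := by positivity
  calc (N ^ γ)⁻¹ * N⁻¹ = x⁻¹ * ((N + x) ^ γ)⁻¹ * (x / N * ((N + x) ^ γ / N ^ γ)) := by
        field_simp
    _ ≤ x⁻¹ * ((N + x) ^ γ)⁻¹ * ((2 * γ) ^ γ * exp (1 / 2) * (exp (x / N) - 1)) := by gcongr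
    _ = _ := by ring

theorem tsum_lintegral_echoMode_le {α ε γ t : ℝ} (hγ : 1 < γ) (hα : 0 < α) (hε : 0 < ε)
    (ht : 0 < t) (s : Set ℝ) :
    ∑' n : ℕ, ∑' m : ℕ, ∫⁻ τ in s, ENNReal.ofReal (echoMode α ε γ t n m τ) ≤
      ENNReal.ofReal (8 / α * ((∑' n : ℕ, (n + 1 : ℝ) ^ (-(γ + 1))) / α * exp (-(3 / 4 * α * t)) +
        (2 * γ) ^ γ * exp (1 / 2) / (γ - 1) * (ε * t) ^ (-γ))) := by
  have hx : 0 < ε * t := by positivity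
  have hγ' : 0 < γ - 1 := by linarith
  have hZ : Summable fun n : ℕ => (n + 1 : ℝ) ^ (-(γ + 1)) := by
    have := (summable_nat_add_iff 1).2 (Real.summable_nat_rpow.2 (by linarith : -(γ + 1) < -1))
    exact_mod_cast this
  have inner : ∀ n : ℕ, ∑' m : ℕ, ∫⁻ τ in s, ENNReal.ofReal (echoMode α ε γ t n m τ) ≤
      ENNReal.ofReal (8 / α * (exp (-(3 / 4 * α * t)) / α)) *
          ENNReal.ofReal ((n + 1 : ℝ) ^ (-(γ + 1))) +
        ENNReal.ofReal (8 / α * ((2 * γ) ^ γ * exp (1 / 2) * (ε * t)⁻¹)) *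
          ENNReal.ofReal ((n + 1 + ε * t) ^ (-γ)) := fun n => by
    have hN : (0 : ℝ) < n + 1 := by positivity
    have hy : 0 < ε * t / (n + 1) := by positivity
    have hle : ∀ m : ℕ, ∫⁻ τ in s, ENNReal.ofReal (echoMode α ε γ t n m τ) ≤
        ENNReal.ofReal (8 / α * (n + 1 : ℝ) ^ (-(γ + 1)) * exp (-(3 / 4 * α * t))) *
            ENNReal.ofReal (exp (-(α * (m + 1)))) +
          ENNReal.ofReal (8 / α * (n + 1 : ℝ) ^ (-(γ + 1))) *
            ENNReal.ofReal (exp (-(ε * t / (n + 1) * (m + 1)))) := fun m => by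
      refine (lintegral_echoMode_le hα n m s).trans ?_
      rw [← ENNReal.ofReal_mul (by positivity), ← ENNReal.ofReal_mul (by positivity),
        ← ENNReal.ofReal_add (by positivity) (by positivity)]
      refine ENNReal.ofReal_le_ofReal ?_
      have h1 : exp (-(3 / 4 * α * ((m + 1) * t))) ≤ exp (-(3 / 4 * α * t)) := by
        have : 0 ≤ α * (m * t) := by positivity
        exact exp_le_exp.2 (by linarith)
      have h2 : exp (-(α * (m + 1))) ≤ 1 := by
        have : 0 ≤ α * (m + 1) := by positivity
        exact exp_le_one_iff.2 (by linarith)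
      have h3 : ε * ((m + 1) * t) / (n + 1) = ε * t / (n + 1) * (m + 1) := by ring
      rw [h3, mul_assoc _ (exp (-(3 / 4 * α * t))), ← mul_add, mul_add (exp (-(α * (m + 1))))]
      have h4 := mul_le_mul_of_nonneg_left h1 (exp_pos (-(α * (m + 1)))).le
      have h5 := mul_le_mul_of_nonneg_right h2 (exp_pos (-(ε * t / (n + 1) * (m + 1)))).le
      gcongr ?_ * ?_
      linarith
    refine (ENNReal.tsum_le_tsum hle).trans ?_
    rw [ENNReal.tsum_add, ENNReal.tsum_mul_left, ENNReal.tsum_mul_left,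
      ENNReal.tsum_ofReal_exp_neg hα, ENNReal.tsum_ofReal_exp_neg hy]
    simp_rw [mul_assoc (8 / α)]
    have h8 : 0 ≤ 8 / α := by positivity
    have ha : 1 / (exp α - 1) ≤ 1 / α :=
      one_div_le_one_div_of_le hα (by linarith [add_one_le_exp α])
    have hb := rpow_div_exp_sub_one_le hγ hN hx
    rw [← ENNReal.ofReal_mul (by positivity), ← ENNReal.ofReal_mul (by positivity),
      ← ENNReal.ofReal_mul (by positivity), ← ENNReal.ofReal_mul (by positivity)]
    refine add_le_add (ENNReal.ofReal_le_ofReal ?_) (ENNReal.ofReal_le_ofReal ?_)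
    · calc _ ≤ 8 / α * ((n + 1 : ℝ) ^ (-(γ + 1)) * exp (-(3 / 4 * α * t))) * (1 / α) := by gcongr
        _ = _ := by ring
    · rw [mul_assoc, mul_assoc (8 / α)]
      gcongr
  refine (ENNReal.tsum_le_tsum inner).trans ?_
  rw [ENNReal.tsum_add, ENNReal.tsum_mul_left, ENNReal.tsum_mul_left,
    ← ENNReal.ofReal_tsum_of_nonneg (fun n => by positivity) hZ]
  refine (add_le_add_right (mul_le_mul_right (ENNReal.tsum_ofReal_rpow_neg_le hγ hx) _) _).trans ?_
  have hZ0 : 0 ≤ ∑' n : ℕ, (n + 1 : ℝ) ^ (-(γ + 1)) := tsum_nonneg fun n => by positivity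
  rw [← ENNReal.ofReal_mul (by positivity), ← ENNReal.ofReal_mul (by positivity),
    ← ENNReal.ofReal_add (by positivity) (by positivity)]
  refine ENNReal.ofReal_le_ofReal (le_of_eq ?_)
  rw [sub_eq_add_neg, rpow_add hx, rpow_one]
  field_simp

theorem echoKernel_nonneg (α γ t : ℝ) {τ : ℝ} (hτ : 0 ≤ τ) : 0 ≤ echoKernel α γ t τ :=
  mul_nonneg (by linarith) (Real.iSup_nonneg fun k => Real.iSup_nonneg fun l => by positivity)

theorem ofReal_echoKernel_le {α ε γ t τ : ℝ} (hα : 0 < α) (hε : 0 < ε) (hτ : 0 < τ)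
    (hτt : τ ≤ t) :
    ENNReal.ofReal (echoKernel α γ t τ) ≤ ENNReal.ofReal (1 + t) *
      (ENNReal.ofReal (exp (ε * (t - τ))) * (ENNReal.ofReal (exp (-(α * t))) +
        ∑' n : ℕ, ∑' m : ℕ, ENNReal.ofReal (echoMode α ε γ t n m τ))) := by
  rw [echoKernel, ENNReal.ofReal_mul (by linarith)]
  gcongr
  set S := ∑' n : ℕ, ∑' m : ℕ, ENNReal.ofReal (echoMode α ε γ t n m τ)
  have hE : 1 ≤ exp (ε * (t - τ)) := one_le_exp (mul_nonneg hε.le (by linarith))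
  rcases eq_or_ne S ⊤ with htop | htop
  · rw [htop, add_top, ENNReal.mul_top (by simpa using exp_pos _)]
    exact le_top
  have hne : ENNReal.ofReal (exp (ε * (t - τ))) * (ENNReal.ofReal (exp (-(α * t))) + S) ≠ ⊤ :=
    ENNReal.mul_ne_top ENNReal.ofReal_ne_top (ENNReal.add_ne_top.2 ⟨ENNReal.ofReal_ne_top, htop⟩)
  rw [ENNReal.ofReal_le_iff_le_toReal hne]
  refine Real.iSup_le (fun k => Real.iSup_le (fun l => ?_) ENNReal.toReal_nonneg)
    ENNReal.toReal_nonneg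
  rw [← ENNReal.ofReal_le_iff_le_toReal hne]
  rcases echo_term_le (γ := γ) hα hε hτ hτt k.2 l.2 with h | ⟨n, m, h⟩
  · refine (ENNReal.ofReal_le_ofReal h).trans ?_
    refine le_trans ?_ (mul_le_mul_right le_self_add _)
    rw [← ENNReal.ofReal_mul (exp_pos _).le]
    exact ENNReal.ofReal_le_ofReal (le_mul_of_one_le_left (exp_pos _).le hE)
  · refine (ENNReal.ofReal_le_ofReal h).trans ?_
    rw [ENNReal.ofReal_mul (exp_pos _).le]
    gcongr
    refine le_trans ?_ le_add_self
    exact (ENNReal.le_tsum m).trans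
      (ENNReal.le_tsum (f := fun n => ∑' m : ℕ, ENNReal.ofReal (echoMode α ε γ t n m τ)) n)

theorem measurable_echoMode (α ε γ t : ℝ) (n m : ℕ) : Measurable (echoMode α ε γ t n m) := by
  unfold echoMode; fun_prop

theorem exp_mul_integral_echoKernel_le {α ε γ t : ℝ} (hγ : 1 < γ) (hα : 0 < α) (hε : 0 < ε)
    (ht : 0 < t) :
    exp (-ε * t) * ∫ τ in (0 : ℝ)..t, echoKernel α γ t τ * exp (ε * τ) ≤
      (1 + t) * (t * exp (-(α * t)) + 8 / α * ((∑' n : ℕ, (n + 1 : ℝ) ^ (-(γ + 1))) / α *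
        exp (-(3 / 4 * α * t)) + (2 * γ) ^ γ * exp (1 / 2) / (γ - 1) * (ε * t) ^ (-γ))) := by
  have hγ' : 0 < γ - 1 := by linarith
  have hZ0 : 0 ≤ ∑' n : ℕ, (n + 1 : ℝ) ^ (-(γ + 1)) := tsum_nonneg fun n => by positivity
  rw [← intervalIntegral.integral_const_mul, intervalIntegral.integral_of_le ht.le]
  refine integral_le_of_lintegral_ofReal_le ?_ (by positivity) ?_
  · filter_upwards [ae_restrict_mem measurableSet_Ioc] with τ hτ
    have := echoKernel_nonneg α γ t hτ.1.le
    simp only [Pi.zero_apply]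
    positivity
  calc ∫⁻ τ in Set.Ioc 0 t, ENNReal.ofReal (exp (-ε * t) * (echoKernel α γ t τ * exp (ε * τ)))
      ≤ ∫⁻ τ in Set.Ioc 0 t, ENNReal.ofReal (1 + t) * (ENNReal.ofReal (exp (-(α * t))) +
          ∑' n : ℕ, ∑' m : ℕ, ENNReal.ofReal (echoMode α ε γ t n m τ)) := by
        refine setLIntegral_mono' measurableSet_Ioc fun τ hτ => ?_
        have e : exp (-ε * t) * (echoKernel α γ t τ * exp (ε * τ)) =
            exp (-(ε * (t - τ))) * echoKernel α γ t τ := by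
          rw [mul_left_comm, ← exp_add, mul_comm]; congr 2; ring
        have e1 : ENNReal.ofReal (exp (-(ε * (t - τ)))) * ENNReal.ofReal (exp (ε * (t - τ))) = 1 := by
          rw [← ENNReal.ofReal_mul (exp_pos _).le, ← exp_add]; simp
        rw [e, ENNReal.ofReal_mul (exp_pos _).le]
        refine (mul_le_mul_right (ofReal_echoKernel_le hα hε hτ.1 hτ.2) _).trans (le_of_eq ?_)
        rw [mul_left_comm, ← mul_assoc (ENNReal.ofReal (exp (-(ε * (t - τ))))), e1, one_mul]
    _ = ENNReal.ofReal (1 + t) * (ENNReal.ofReal (exp (-(α * t))) * ENNReal.ofReal t +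
          ∑' n : ℕ, ∑' m : ℕ, ∫⁻ τ in Set.Ioc 0 t, ENNReal.ofReal (echoMode α ε γ t n m τ)) := by
        have hmeas : ∀ n m, Measurable fun τ => ENNReal.ofReal (echoMode α ε γ t n m τ) :=
          fun n m => (measurable_echoMode α ε γ t n m).ennreal_ofReal
        rw [lintegral_const_mul' _ _ ENNReal.ofReal_ne_top, lintegral_add_left measurable_const,
          setLIntegral_const, Real.volume_Ioc, sub_zero,
          lintegral_tsum fun n => (Measurable.tsum (hmeas n)).aemeasurable]
        simp_rw [lintegral_tsum fun m => (hmeas _ m).aemeasurable]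
    _ ≤ _ := by
        rw [ENNReal.ofReal_mul (by positivity),
          ENNReal.ofReal_add (p := t * exp (-(α * t))) (by positivity) (by positivity),
          mul_comm t, ENNReal.ofReal_mul (exp_pos _).le]
        gcongr
        exact tsum_lintegral_echoMode_le hγ hα hε ht _

theorem one_add_le_mul_exp {α t : ℝ} (hα : 0 < α) (hα1 : α ≤ 1) :
    1 + t ≤ 4 / α * exp (α * t / 4) := by
  rw [div_mul_eq_mul_div, le_div_iff₀ hα]
  nlinarith [add_one_le_exp (α * t / 4)]

theorem echo_kernel_exponential_moment :
    ∀ γ : ℝ, 1 < γ → ∃ abar > (0:ℝ), ∃ C > (0:ℝ),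
      ∀ α ε : ℝ, 0 < α → α ≤ abar → 0 < ε → ε < 1 → ∀ t : ℝ, 0 < t →
        Real.exp (-ε * t) * ∫ τ in (0:ℝ)..t, echoKernel α γ t τ * Real.exp (ε * τ) ≤
          C * (1 / (α * ε ^ γ * t ^ (γ - 1))
              + (1 / (α * ε ^ γ * t ^ γ)) * Real.log (1/α)
              + 1 / (α^2 * ε ^ (1 + γ) * t ^ (1 + γ))
              + (1 / α^3 + (1 / (α^2 * ε)) * Real.log (1/α)) * Real.exp (-ε * t / 4)
              + Real.exp (-α * t / 2) / α^3) := by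
  intro γ hγ
  have hγ' : 0 < γ - 1 := by linarith
  set Z : ℝ := ∑' n : ℕ, (n + 1 : ℝ) ^ (-(γ + 1))
  have hZ0 : 0 ≤ Z := tsum_nonneg fun n => by positivity
  set D : ℝ := (2 * γ) ^ γ * exp (1 / 2) / (γ - 1)
  have hD0 : 0 ≤ D := by positivity
  refine ⟨exp (-1), exp_pos _, 16 + 32 * Z + 8 * D, by positivity, ?_⟩
  intro α ε hα hαb hε _ t ht
  have hα1 : α ≤ 1 := hαb.trans (exp_le_one_iff.2 (by norm_num))
  have hlog : 1 ≤ log (1 / α) := by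
    rw [one_div, log_inv]
    have := log_le_log hα hαb
    rw [log_exp] at this
    linarith
  refine (exp_mul_integral_echoKernel_le hγ hα hε ht).trans ?_
  have h1t := one_add_le_mul_exp (t := t) hα hα1
  have hα0 := hα.ne'
  have e1 : exp (α * t / 4) * exp (α * t / 4) * exp (-(α * t)) = exp (-α * t / 2) := by
    rw [← exp_add, ← exp_add]; congr 1; ring
  have e2 : exp (α * t / 4) * exp (-(3 / 4 * α * t)) = exp (-α * t / 2) := by
    rw [← exp_add]; congr 1; ring
  have b1 : (1 + t) * (t * exp (-(α * t))) ≤ 16 * (exp (-α * t / 2) / α ^ 3) := by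
    calc (1 + t) * (t * exp (-(α * t)))
        ≤ 4 / α * exp (α * t / 4) * (4 / α * exp (α * t / 4) * exp (-(α * t))) := by
          gcongr
          linarith
      _ = 16 * (exp (-α * t / 2) / α ^ 2) := by rw [← e1]; field_simp; norm_num
      _ ≤ _ := by
          have : α ^ 3 ≤ α ^ 2 := pow_le_pow_of_le_one hα.le hα1 (by norm_num)
          gcongr
  have b2 : (1 + t) * (8 / α * (Z / α * exp (-(3 / 4 * α * t)))) ≤
      32 * Z * (exp (-α * t / 2) / α ^ 3) := by
    calc (1 + t) * (8 / α * (Z / α * exp (-(3 / 4 * α * t))))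
        ≤ 4 / α * exp (α * t / 4) * (8 / α * (Z / α * exp (-(3 / 4 * α * t)))) := by gcongr
      _ = _ := by rw [← e2]; field_simp; ring
  have b3 : (1 + t) * (8 / α * (D * (ε * t) ^ (-γ))) =
      8 * D * (1 / (α * ε ^ γ * t ^ (γ - 1)) + 1 / (α * ε ^ γ * t ^ γ)) := by
    have h1 : 0 < ε ^ γ := by positivity
    have h2 : 0 < t ^ γ := by positivity
    rw [rpow_neg (by positivity), mul_rpow hε.le ht.le, rpow_sub_one ht.ne']
    field_simp
    ring
  have p1 : 0 ≤ 1 / (α * ε ^ γ * t ^ (γ - 1)) := by positivity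
  have p2 : 0 ≤ 1 / (α * ε ^ γ * t ^ γ) := by positivity
  have p3 : 0 ≤ 1 / (α ^ 2 * ε ^ (1 + γ) * t ^ (1 + γ)) := by positivity
  have p4 : 0 ≤ (1 / α ^ 3 + (1 / (α ^ 2 * ε)) * log (1 / α)) * exp (-ε * t / 4) := by
    have : 0 ≤ log (1 / α) := by linarith
    positivity
  have p5 : 0 ≤ exp (-α * t / 2) / α ^ 3 := by positivity
  have p6 := le_mul_of_one_le_right p2 hlog
  set A := 1 / (α * ε ^ γ * t ^ (γ - 1))
  set B := 1 / (α * ε ^ γ * t ^ γ)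
  set E := exp (-α * t / 2) / α ^ 3
  calc _ ≤ (16 + 32 * Z) * E + 8 * D * (A + B) := by rw [← b3]; linarith
    _ ≤ (16 + 32 * Z + 8 * D) * E + (16 + 32 * Z + 8 * D) * (A + B * log (1 / α)) :=
        add_le_add (mul_le_mul_of_nonneg_right (by linarith) p5)
          (mul_le_mul (by linarith) (by linarith) (by positivity) (by positivity))
    _ = (16 + 32 * Z + 8 * D) * (A + B * log (1 / α) + E) := by ring
    _ ≤ _ := mul_le_mul_of_nonneg_left (by linarith) (by positivity)
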